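/- arXiv:1004.3573 — 4 statements merged into one kernel-verified Lean document; each statement's English description precedes it below -/
import Mathlib

section
/- Let L be a complete lattice, S ⊆ L a complete sublattice, and F ⊆ S a subset upward-closed in S. Then the preimage of F under inner daseinisation equals the cone of F, i.e. {p ∈ L | δⁱ_S(p) ∈ F} = C(F) = {p ∈ L | ∃ q ∈ F, q ≤ p}. (This is the order-theoretic content of the paper's Lemma: for a von Neumann algebra N and a von Neumann subalgebra T with the same unit, and any filter F in the projection lattice P(T), one has (δⁱ_T)⁻¹(F) = C_N(F).) -/
/-- Inner daseinisation of `p` to the subset `S`: the largest element of `S` below `p`. -/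
def dInner {L : Type*} [CompleteLattice L] (S : Set L) (p : L) : L :=
  sSup {q | q ∈ S ∧ q ≤ p}

/-- The cone of `F` in `L`: all elements lying above some element of `F`. -/
def cone {L : Type*} [CompleteLattice L] (F : Set L) : Set L :=
  {p | ∃ q ∈ F, q ≤ p}

/-- For a complete sublattice `S` of a complete lattice `L` and a subset `F ⊆ S` which is
upward-closed in `S`, the preimage of `F` under inner daseinisation equals the cone of `F`. -/
theorem preimage_dInner_eq_cone {L : Type*} [CompleteLattice L] (S : Set L)
    (hSup : ∀ T : Set L, T ⊆ S → sSup T ∈ S)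
    (hInf : ∀ T : Set L, T ⊆ S → sInf T ∈ S)
    (F : Set L) (hFS : F ⊆ S)
    (hup : ∀ q ∈ F, ∀ q' ∈ S, q ≤ q' → q' ∈ F) :
    {p : L | dInner S p ∈ F} = cone F := by
  ext p
  constructor
  · intro h
    exact ⟨dInner S p, h, sSup_le fun q hq => hq.2⟩
  · rintro ⟨q, hq, hqp⟩
    exact hup q hq _ (hSup _ fun x hx => hx.1) (le_sSup ⟨hFS hq, hqp⟩)
end

section
/- Let L be a complete lattice, S ⊆ L a complete sublattice, F ⊆ S a subset upward-closed in S, and E : ℝ → L a monotone map. Then {r ∈ ℝ | δⁱ_S(E(r)) ∈ F} = {r ∈ ℝ | E(r) ∈ C(F)}; in particular the two sets have the same infimum in ℝ: sInf {r | δⁱ_S(E(r)) ∈ F} = sInf {r | E(r) ∈ C(F)}. (This is the order-theoretic core of the paper's Proposition on observable functions: since the spectral family of the outer daseinised operator δᵒ_T(A) at r is δⁱ_T(E^A_r), it yields f_{δᵒ_T(A)}(F) = f_A(C_N(F)), where f_A(F) = inf {r | E^A_r ∈ F} is the observable function of A.) -/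
/-- For a complete sublattice `S` of a complete lattice `L`, a subset `F ⊆ S` upward-closed
in `S`, and a monotone map `E : ℝ → L` (abstracting a spectral family), the set of `r` with
`δⁱ_S(E r) ∈ F` equals the set of `r` with `E r ∈ C(F)`; in particular the two sets of reals
have the same infimum. -/
theorem observableFunction_dInner {L : Type*} [CompleteLattice L] (S : Set L)
    (hSup : ∀ T : Set L, T ⊆ S → sSup T ∈ S)
    (hInf : ∀ T : Set L, T ⊆ S → sInf T ∈ S)
    (F : Set L) (hFS : F ⊆ S)
    (hup : ∀ q ∈ F, ∀ q' ∈ S, q ≤ q' → q' ∈ F)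
    (E : ℝ → L) (hE : Monotone E) :
    {r : ℝ | dInner S (E r) ∈ F} = {r : ℝ | E r ∈ cone F} ∧
    sInf {r : ℝ | dInner S (E r) ∈ F} = sInf {r : ℝ | E r ∈ cone F} := by
  have h : {r : ℝ | dInner S (E r) ∈ F} = {r : ℝ | E r ∈ cone F} := by
    ext r
    constructor
    · intro hr
      exact ⟨dInner S (E r), hr, sSup_le fun q hq => hq.2⟩
    · rintro ⟨q, hq, hle⟩
      exact hup q hq _ (hSup _ fun x hx => hx.1) (le_sSup ⟨hFS hq, hle⟩)
  exact ⟨h, by rw [h]⟩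
end

section
/- Let L be a complete lattice, S ⊆ L a complete sublattice, c : L → L an antitone involution with c '' S = S, F ⊆ S a subset upward-closed in S, and E : ℝ → L a monotone map. Then the sets {r ∈ ℝ | c(⨅_{s > r} δᵒ_S(E(s))) ∈ F} and {r ∈ ℝ | c(E(r)) ∈ C(F)} have the same supremum in ℝ: sSup {r | c(⨅_{s>r} δᵒ_S(E(s))) ∈ F} = sSup {r | c(E(r)) ∈ C(F)}. (This is the order-theoretic core of the paper's Proposition on antonymous functions: since the spectral family of the inner daseinised operator δⁱ_T(A) at r is ⋀_{s>r} δᵒ_T(E^A_s) and the orthocomplement P ↦ 1 − P plays the role of c, it yields g_{δⁱ_T(A)}(F) = g_A(C_N(F)), where g_A(F) = sup {r | 1 − E^A_r ∈ F} is the antonymous function of A.) -/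
/-- Outer daseinisation of `p` to the subset `S`: the smallest element of `S` above `p`. -/
def dOuter {L : Type*} [CompleteLattice L] (S : Set L) (p : L) : L :=
  sInf {q | q ∈ S ∧ p ≤ q}

/-- Order-theoretic core of the proposition on antonymous functions: for a complete sublattice
`S` of a complete lattice `L`, an antitone involution `c` with `c '' S = S`, a subset `F ⊆ S`
upward-closed in `S`, and a monotone map `E : ℝ → L` (abstracting a spectral family), the sets
`{r | c(⨅_{s > r} δᵒ_S(E s)) ∈ F}` and `{r | c(E r) ∈ C(F)}` have the same supremum in `ℝ`. -/
theorem antonymousFunction_dInner {L : Type*} [CompleteLattice L] (S : Set L)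
    (hSup : ∀ T : Set L, T ⊆ S → sSup T ∈ S)
    (hInf : ∀ T : Set L, T ⊆ S → sInf T ∈ S)
    (c : L → L) (hcc : ∀ p, c (c p) = p) (hc : Antitone c) (hcS : c '' S = S)
    (F : Set L) (hFS : F ⊆ S)
    (hup : ∀ q ∈ F, ∀ q' ∈ S, q ≤ q' → q' ∈ F)
    (E : ℝ → L) (hE : Monotone E) :
    sSup {r : ℝ | c (⨅ s ∈ Set.Ioi r, dOuter S (E s)) ∈ F} =
      sSup {r : ℝ | c (E r) ∈ cone F} := by
  have cS : ∀ p ∈ S, c p ∈ S := fun p hp => hcS ▸ Set.mem_image_of_mem c hp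
  have hdS : ∀ p, dOuter S p ∈ S := fun p => hInf _ fun q hq => hq.1
  have hle : ∀ p, p ≤ dOuter S p := fun p => le_sInf fun q hq => hq.2
  have hiS : ∀ r : ℝ, (⨅ s ∈ Set.Ioi r, dOuter S (E s)) ∈ S := by
    intro r
    rw [← sInf_image]
    refine hInf _ ?_
    rintro _ ⟨s, _, rfl⟩
    exact hdS _
  set A : Set ℝ := {r : ℝ | c (⨅ s ∈ Set.Ioi r, dOuter S (E s)) ∈ F} with hA
  set B : Set ℝ := {r : ℝ | c (E r) ∈ cone F} with hB
  have hAB : A ⊆ B := by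
    intro r hr
    refine ⟨_, hr, hc ?_⟩
    exact le_iInf₂ fun s hs => (hE (le_of_lt hs)).trans (hle _)
  have hBA : ∀ r ∈ B, ∀ r' < r, r' ∈ A := by
    rintro r ⟨q, hq, hqr⟩ r' hr'
    refine hup q hq _ (cS _ (hiS r')) ?_
    have h1 : E r ≤ c q := by
      have := hc hqr
      rwa [hcc] at this
    have h2 : dOuter S (E r) ≤ c q := sInf_le ⟨cS _ (hFS hq), h1⟩
    have h3 : (⨅ s ∈ Set.Ioi r', dOuter S (E s)) ≤ c q := (iInf₂_le r hr').trans h2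
    have := hc h3
    rwa [hcc] at this
  have hub : upperBounds A = upperBounds B := by
    refine Set.Subset.antisymm (fun u hu r hr => ?_) (upperBounds_mono_set hAB)
    exact le_of_forall_lt_imp_le_of_dense fun r' hr' => hu (hBA r hr r' hr')
  rcases B.eq_empty_or_nonempty with h0 | ⟨r, hr⟩
  · have hA0 : A = ∅ := by
      rw [h0] at hAB
      exact Set.subset_empty_iff.1 hAB
    rw [h0, hA0]
  · have hAne : A.Nonempty := ⟨r - 1, hBA r hr _ (by linarith)⟩
    by_cases hb : BddAbove B
    · have h1 := isLUB_csSup hAne (hb.mono hAB)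
      have h2 := isLUB_csSup ⟨r, hr⟩ hb
      unfold IsLUB at h1 h2
      rw [hub] at h1
      exact IsLeast.unique h1 h2
    · have ha : ¬ BddAbove A := by
        unfold BddAbove at hb ⊢
        rwa [hub]
      rw [Real.sSup_of_not_bddAbove ha, Real.sSup_of_not_bddAbove hb]
end

section
/- Let A be a commutative unital C*-algebra over ℂ. For every clopen subset U of the Gel'fand spectrum Σ_A there exists a projection p ∈ A with S_p = U. (Together with the clopenness of each S_p, this says the map p ↦ S_p from projections of A onto the clopen subsets of Σ_A is surjective; its inverse sends a clopen set to the preimage of its characteristic function under the Gel'fand transform.) -/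
open WeakDual

/-- For a commutative unital C*-algebra `A`, every clopen subset `U` of the Gel'fand spectrum
(character space) of `A` is of the form `S_p = {λ | λ(p) = 1}` for some projection `p ∈ A`:
the map `p ↦ S_p` from projections onto clopen subsets is surjective. -/
theorem clopen_eq_S_of_projection {A : Type*} [CommCStarAlgebra A]
    (U : Set (characterSpace ℂ A)) (hU : IsClopen U) :
    ∃ p : A, star p = p ∧ p * p = p ∧ {l : characterSpace ℂ A | l p = 1} = U := by
  classical
  let f : C(characterSpace ℂ A, ℂ) :=
    ⟨U.indicator (fun _ => (1 : ℂ)), continuous_const.indicator (by simp [hU.frontier_eq])⟩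
  have hf : ∀ l, f l = if l ∈ U then 1 else 0 := fun l => by
    simp [f, Set.indicator_apply]
  obtain ⟨p, hp⟩ := (gelfandTransform_bijective A).2 f
  have hinj := (gelfandTransform_bijective A).1
  have hlp : ∀ l : characterSpace ℂ A, l p = if l ∈ U then 1 else 0 := fun l => by
    rw [← hf l, ← hp]
    rfl
  refine ⟨p, hinj ?_, hinj ?_, ?_⟩
  · rw [gelfandTransform_map_star, hp]
    ext l
    rw [ContinuousMap.star_apply, hf]
    split_ifs <;> simp
  · rw [map_mul, hp]
    ext l
    rw [ContinuousMap.mul_apply, hf]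
    split_ifs <;> simp
  · ext l
    rw [Set.mem_setOf_eq, hlp]
    split_ifs with h <;> simp [h]
end
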